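/- Let λ ∈ (0,1/2) with log 2 / (−log λ) > 2 − q/q₀ where q = 3/2 and q₀ = 13/10, let F = C_λ ⊂ (−1/2,1/2) × {0} ⊂ ℝ² be the (1−2λ)-middle Cantor set (embedded in the x₁-axis), and let ω(x) = |x|^{1/2}. Then F has zero 1-dimensional Lebesgue measure, yet there exist c₀ > 0 and r₀ = 1/3 such that for every x₀ ∈ F and 0 < r < r₀: Cap_{q,ω}(F ∩ Q_r(x₀), ℝ²) / ω(Q_r(x₀)) ≥ c₀ r^{−q}. -/

import Mathlib

open MeasureTheory Metric Set

noncomputable section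

abbrev Euc (n : ℕ) := EuclideanSpace ℝ (Fin n)

/-- Axis-parallel open cube of half side length `r` centered at `x₀`. -/
def cube (n : ℕ) (x₀ : Euc n) (r : ℝ) : Set (Euc n) := {x | ∀ i, |x i - x₀ i| < r}

/-- `μ` satisfies the Muckenhoupt `A_p` condition with constant `C`. -/
def ApBound (n : ℕ) (p : ℝ) (μ : Euc n → ℝ) (C : ℝ) : Prop :=
  ∀ (x₀ : Euc n) (r : ℝ), 0 < r →
    (⨍ x in cube n x₀ r, μ x) *
      (⨍ x in cube n x₀ r, μ x ^ (-1 / (p - 1))) ^ (p - 1) ≤ C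

/-- The weighted variational `(q,μ)`-capacity of `K` relative to the open set `U`:
`inf { ∫_U |∇φ|^q μ : φ ∈ C_0^∞(U), φ ≥ 1 on K }`. -/
def Cap (n : ℕ) (q : ℝ) (μ : Euc n → ℝ) (K U : Set (Euc n)) : ℝ :=
  sInf {t | ∃ φ : Euc n → ℝ, ContDiff ℝ (⊤ : ℕ∞) φ ∧ HasCompactSupport φ ∧
    tsupport φ ⊆ U ∧ (∀ x ∈ K, 1 ≤ φ x) ∧
    t = ∫ x in U, ‖fderiv ℝ φ x‖ ^ q * μ x}

/-- The iterates of the `(1-2λ)`-middle Cantor construction on `[-1/2, 1/2]`. -/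
def cantorIter (lam : ℝ) : ℕ → Set ℝ
  | 0 => Set.Icc (-(1/2)) (1/2)
  | k + 1 =>
      (fun t => lam * t - (1 - lam) / 2) '' cantorIter lam k ∪
        (fun t => lam * t + (1 - lam) / 2) '' cantorIter lam k

/-- The `(1-2λ)`-middle Cantor set `C_λ ⊆ [-1/2,1/2]`. -/
def midCantorSet (lam : ℝ) : Set ℝ := ⋂ k, cantorIter lam k

/-- `C_λ` embedded in the `x₁`-axis of `ℝ²`. -/
def cantorF (lam : ℝ) : Set (Euc 2) := {x | x 1 = 0 ∧ x 0 ∈ midCantorSet lam}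

section CantorSet

variable {lam : ℝ}

lemma cantorIter_subset_Icc (h0 : 0 < lam) (h1 : lam < 1 / 2) (k : ℕ) :
    cantorIter lam k ⊆ Icc (-(1 / 2)) (1 / 2) := by
  induction k with
  | zero => exact subset_rfl
  | succ k ih =>
    rintro _ (⟨t, ht, rfl⟩ | ⟨t, ht, rfl⟩) <;> obtain ⟨h2, h3⟩ := ih ht <;>
      constructor <;> dsimp only <;> nlinarith

lemma midCantorSet_subset_Icc : midCantorSet lam ⊆ Icc (-(1 / 2)) (1 / 2) :=
  fun _ ht => mem_iInter.1 ht 0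

lemma lower_mem_midCantorSet (h0 : 0 < lam) (h1 : lam < 1 / 2) {t : ℝ}
    (ht : t ∈ midCantorSet lam) : lam * t - (1 - lam) / 2 ∈ midCantorSet lam := by
  have key : ∀ k, lam * t - (1 - lam) / 2 ∈ cantorIter lam (k + 1) :=
    fun k => Or.inl ⟨t, mem_iInter.1 ht k, rfl⟩
  refine mem_iInter.2 fun k => ?_
  cases k with
  | zero => exact cantorIter_subset_Icc h0 h1 1 (key 0)
  | succ k => exact key k

lemma upper_mem_midCantorSet (h0 : 0 < lam) (h1 : lam < 1 / 2) {t : ℝ}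
    (ht : t ∈ midCantorSet lam) : lam * t + (1 - lam) / 2 ∈ midCantorSet lam := by
  have key : ∀ k, lam * t + (1 - lam) / 2 ∈ cantorIter lam (k + 1) :=
    fun k => Or.inr ⟨t, mem_iInter.1 ht k, rfl⟩
  refine mem_iInter.2 fun k => ?_
  cases k with
  | zero => exact cantorIter_subset_Icc h0 h1 1 (key 0)
  | succ k => exact key k

lemma exists_eq_of_mem_midCantorSet (h0 : 0 < lam) (h1 : lam < 1 / 2) {t : ℝ}
    (ht : t ∈ midCantorSet lam) :
    ∃ u ∈ midCantorSet lam, t = lam * u - (1 - lam) / 2 ∨ t = lam * u + (1 - lam) / 2 := by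
  have hk : ∀ k, t ∈ cantorIter lam (k + 1) := fun k => mem_iInter.1 ht (k + 1)
  rcases le_total t 0 with h | h
  · refine ⟨(t + (1 - lam) / 2) / lam, mem_iInter.2 fun k => ?_, Or.inl (by field_simp; ring)⟩
    rcases hk k with ⟨u, hu, rfl⟩ | ⟨u, hu, rfl⟩
    · convert hu using 1
      field_simp
      ring
    · have := (cantorIter_subset_Icc h0 h1 k hu).1
      dsimp only at h
      nlinarith
  · refine ⟨(t - (1 - lam) / 2) / lam, mem_iInter.2 fun k => ?_, Or.inr (by field_simp; ring)⟩
    rcases hk k with ⟨u, hu, rfl⟩ | ⟨u, hu, rfl⟩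
    · have := (cantorIter_subset_Icc h0 h1 k hu).2
      dsimp only at h
      nlinarith
    · convert hu using 1
      field_simp
      ring

lemma neg_half_mem_midCantorSet : -(1 / 2) ∈ midCantorSet lam := by
  refine mem_iInter.2 fun k => ?_
  induction k with
  | zero => exact left_mem_Icc.2 (by norm_num)
  | succ k ih => exact Or.inl ⟨_, ih, by dsimp only; ring⟩

/-- The middle gap of the construction separates the Cantor set from the origin. -/
lemma le_abs_of_mem_midCantorSet (h0 : 0 < lam) {t : ℝ}
    (ht : t ∈ midCantorSet lam) : 1 / 2 - lam ≤ |t| := by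
  rcases mem_iInter.1 ht 1 with ⟨u, hu, rfl⟩ | ⟨u, hu, rfl⟩ <;> obtain ⟨h2, h3⟩ := hu
  · refine le_trans ?_ (neg_le_abs _)
    nlinarith
  · refine le_trans ?_ (le_abs_self _)
    nlinarith

/-- `[a, a + l]` carries a scaled copy of the Cantor set contained in the Cantor set. -/
def IsCantorCell (lam a l : ℝ) : Prop :=
  ∀ t ∈ midCantorSet lam, a + l * (t + 1 / 2) ∈ midCantorSet lam

lemma IsCantorCell.left_mem {a l : ℝ}
    (h : IsCantorCell lam a l) : a ∈ midCantorSet lam := by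
  have := h _ (neg_half_mem_midCantorSet)
  simpa using this

lemma IsCantorCell.lower (h0 : 0 < lam) (h1 : lam < 1 / 2) {a l : ℝ}
    (h : IsCantorCell lam a l) : IsCantorCell lam a (lam * l) := by
  intro t ht
  convert h _ (lower_mem_midCantorSet h0 h1 ht) using 1
  ring

lemma IsCantorCell.upper (h0 : 0 < lam) (h1 : lam < 1 / 2) {a l : ℝ}
    (h : IsCantorCell lam a l) : IsCantorCell lam (a + (1 - lam) * l) (lam * l) := by
  intro t ht
  convert h _ (upper_mem_midCantorSet h0 h1 ht) using 1
  ring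

lemma exists_isCantorCell (h0 : 0 < lam) (h1 : lam < 1 / 2) {x : ℝ}
    (hx : x ∈ midCantorSet lam) (m : ℕ) :
    ∃ a, IsCantorCell lam a (lam ^ m) ∧
      ∃ t ∈ midCantorSet lam, x = a + lam ^ m * (t + 1 / 2) := by
  induction m with
  | zero => exact ⟨-(1 / 2), fun t ht => by simpa using ht, x, hx, by simp⟩
  | succ m ih =>
    obtain ⟨a, ha, t, ht, rfl⟩ := ih
    obtain ⟨u, hu, rfl | rfl⟩ := exists_eq_of_mem_midCantorSet h0 h1 ht
    · exact ⟨a, by simpa only [pow_succ'] using ha.lower h0 h1, u, hu, by ring⟩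
    · exact ⟨a + (1 - lam) * lam ^ m, by simpa only [pow_succ'] using ha.upper h0 h1, u, hu, by ring⟩

open scoped Pointwise in
lemma volume_image_mul_add (c : ℝ) (hc : 0 < c) (b : ℝ) (s : Set ℝ) :
    volume ((fun t => c * t + b) '' s) = ENNReal.ofReal c * volume s := by
  have : (fun t => c * t + b) '' s = (fun t => t + b) '' (c • s) := by
    rw [← image_smul, image_image]
    rfl
  rw [this, image_add_right, measure_preimage_add_right, Measure.addHaar_smul]
  simp [abs_of_pos hc]

lemma volume_cantorIter_le (h0 : 0 < lam) (k : ℕ) :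
    volume (cantorIter lam k) ≤ ENNReal.ofReal ((2 * lam) ^ k) := by
  induction k with
  | zero =>
    simp only [cantorIter, Real.volume_Icc, pow_zero]
    norm_num
  | succ k ih =>
    refine (measure_union_le _ _).trans ?_
    simp only [sub_eq_add_neg]
    rw [volume_image_mul_add lam h0, volume_image_mul_add lam h0, ← two_mul, pow_succ',
      ENNReal.ofReal_mul (by positivity), ENNReal.ofReal_mul (by norm_num), ← mul_assoc]
    rw [ENNReal.ofReal_ofNat]
    gcongr

lemma volume_midCantorSet (h0 : 0 < lam) (h1 : lam < 1 / 2) : volume (midCantorSet lam) = 0 := by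
  have hlim : Filter.Tendsto (fun k : ℕ => ENNReal.ofReal ((2 * lam) ^ k)) Filter.atTop
      (nhds 0) := by
    rw [← ENNReal.ofReal_zero]
    exact ENNReal.tendsto_ofReal
      (tendsto_pow_atTop_nhds_zero_of_lt_one (by positivity) (by linarith))
  refine le_antisymm (ge_of_tendsto' hlim fun k => ?_) zero_le
  exact (measure_mono (iInter_subset _ k)).trans (volume_cantorIter_le h0 k)

lemma quarter_lt_of_dim (h0 : 0 < lam) (h1 : lam < 1 / 2)
    (hdim : 2 - (3/2 : ℝ) / (13/10 : ℝ) < Real.log 2 / (-Real.log lam)) : 1 / 4 < lam := by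
  have hlog : 0 < -Real.log lam := neg_pos.2 (Real.log_neg h0 (by linarith))
  rw [lt_div_iff₀ hlog] at hdim
  have h4 : Real.log (1 / 4) < Real.log lam := by
    rw [one_div, Real.log_inv, show (4 : ℝ) = 2 ^ 2 by norm_num, Real.log_pow]
    push_cast
    nlinarith
  exact (Real.log_lt_log_iff (by norm_num) h0).1 h4

end CantorSet

section BoxIntegral

/-- The point of the `x₁`-axis with first coordinate `a`. -/
def axisPoint (a : ℝ) : Euc 2 := !₂[a, 0]

/-- A reference disc inside `[0, 1] × [1, 2]`. -/
def refDisc : Set (Euc 2) := closedBall !₂[1 / 2, 3 / 2] (1 / 2)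

/-- The integral of `φ` over the copy of `refDisc` scaled by `s` and based at `axisPoint a`,
in the coordinates of `refDisc`. -/
def discIntegral (φ : Euc 2 → ℝ) (a s : ℝ) : ℝ := ∫ u in refDisc, φ (axisPoint a + s • u)

/-- The integrand `|∇φ|^{3/2}` of the unweighted energy. -/
def gradPow (φ : Euc 2 → ℝ) (x : Euc 2) : ℝ := ‖fderiv ℝ φ x‖ ^ (3 / 2 : ℝ)

lemma isCompact_refDisc : IsCompact refDisc := isCompact_closedBall _ _

lemma measurableSet_refDisc : MeasurableSet refDisc := isClosed_closedBall.measurableSet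

lemma volume_real_refDisc_pos : 0 < volume.real refDisc := by
  refine ENNReal.toReal_pos ?_ isCompact_refDisc.measure_lt_top.ne
  exact (measure_closedBall_pos _ _ (by norm_num)).ne'

lemma mem_refDisc_zero {u : Euc 2} (hu : u ∈ refDisc) : u 0 ∈ Icc (0 : ℝ) 1 := by
  have h := (PiLp.norm_apply_le _ (0 : Fin 2)).trans (mem_closedBall_iff_norm.1 hu)
  simp only [PiLp.sub_apply, Real.norm_eq_abs, abs_le, Matrix.cons_val_zero] at h
  constructor <;> linarith

lemma mem_refDisc_one {u : Euc 2} (hu : u ∈ refDisc) : u 1 ∈ Icc (1 : ℝ) 2 := by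
  have h := (PiLp.norm_apply_le _ (1 : Fin 2)).trans (mem_closedBall_iff_norm.1 hu)
  simp only [PiLp.sub_apply, Real.norm_eq_abs, abs_le, Matrix.cons_val_one,
    Matrix.cons_val_fin_one] at h
  constructor <;> linarith

lemma norm_le_three_of_mem_refDisc {u : Euc 2} (hu : u ∈ refDisc) : ‖u‖ ≤ 3 := by
  obtain ⟨h1, h2⟩ := mem_refDisc_zero hu
  obtain ⟨h3, h4⟩ := mem_refDisc_one hu
  refine abs_le_of_sq_le_sq' ?_ (by norm_num) |>.2
  rw [EuclideanSpace.real_norm_sq_eq, Fin.sum_univ_two]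
  nlinarith

@[simp] lemma axisPoint_add_smul_zero (a s : ℝ) (u : Euc 2) :
    (axisPoint a + s • u) 0 = a + s * u 0 := by simp [axisPoint]

@[simp] lemma axisPoint_add_smul_one (a s : ℝ) (u : Euc 2) :
    (axisPoint a + s • u) 1 = s * u 1 := by simp [axisPoint]

lemma norm_axisPoint (a : ℝ) : ‖axisPoint a‖ = |a| := by
  rw [EuclideanSpace.norm_eq, Fin.sum_univ_two]
  simp [axisPoint, Real.sqrt_sq_eq_abs]

lemma setIntegral_comp_axisPoint_le {g : Euc 2 → ℝ} (hg : Integrable g) (h0 : ∀ x, 0 ≤ g x)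
    {R : Set (Euc 2)} (hR : MeasurableSet R) {a s : ℝ} (hs : 0 < s)
    (hsub : ∀ u ∈ refDisc, axisPoint a + s • u ∈ R) :
    ∫ u in refDisc, g (axisPoint a + s • u) ≤ (s ^ 2)⁻¹ * ∫ x in R, g x := by
  have hgR : Integrable (R.indicator g) := hg.indicator hR
  have hint : Integrable fun u => R.indicator g (axisPoint a + s • u) :=
    (hgR.comp_add_left (axisPoint a)).comp_smul hs.ne'
  calc ∫ u in refDisc, g (axisPoint a + s • u)
      = ∫ u in refDisc, R.indicator g (axisPoint a + s • u) :=
        setIntegral_congr_fun measurableSet_refDisc fun u hu =>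
          (indicator_of_mem (hsub u hu) g).symm
    _ ≤ ∫ u, R.indicator g (axisPoint a + s • u) :=
        setIntegral_le_integral hint (Filter.Eventually.of_forall fun u =>
          indicator_nonneg (fun x _ => h0 x) _)
    _ = (s ^ 2)⁻¹ * ∫ x in R, g x := by
        rw [Measure.integral_comp_smul volume (fun u => R.indicator g (axisPoint a + u)) s,
          integral_add_left_eq_self (R.indicator g), integral_indicator hR]
        simp [abs_of_pos hs]

lemma setIntegral_le_rpow_mul {h : Euc 2 → ℝ} (hc : Continuous h) (h0 : ∀ x, 0 ≤ h x) :
    ∫ u in refDisc, h u ≤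
      volume.real refDisc ^ (1 / 3 : ℝ) * (∫ u in refDisc, h u ^ (3 / 2 : ℝ)) ^ (2 / 3 : ℝ) := by
  have hfin : IsFiniteMeasure (volume.restrict refDisc) :=
    ⟨by simpa using isCompact_refDisc.measure_lt_top⟩
  have hpq : (3 / 2 : ℝ).HolderConjugate 3 := by
    rw [Real.holderConjugate_iff]; norm_num
  obtain ⟨C, hC⟩ := isCompact_refDisc.exists_bound_of_continuousOn hc.continuousOn
  have hmem : MemLp h (ENNReal.ofReal (3 / 2)) (volume.restrict refDisc) :=
    MemLp.of_bound hc.aestronglyMeasurable C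
      (ae_restrict_of_forall_mem measurableSet_refDisc hC)
  have := integral_mul_le_Lp_mul_Lq_of_nonneg (μ := volume.restrict refDisc) hpq
    (Filter.Eventually.of_forall h0) (Filter.Eventually.of_forall fun _ => zero_le_one)
    hmem (memLp_const (1 : ℝ))
  simp only [mul_one, Real.one_rpow, integral_const, measureReal_restrict_apply_univ,
    smul_eq_mul] at this
  rw [mul_comm]
  convert this using 3
  norm_num

variable {φ : Euc 2 → ℝ}

lemma gradPow_nonneg (x : Euc 2) : 0 ≤ gradPow φ x := by unfold gradPow; positivity

lemma continuous_gradPow (hφ : ContDiff ℝ 1 φ) : Continuous (gradPow φ) :=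
  (hφ.continuous_fderiv one_ne_zero).norm.rpow_const fun _ => Or.inr (by norm_num)

lemma hasCompactSupport_gradPow (hc : HasCompactSupport φ) : HasCompactSupport (gradPow φ) :=
  (hc.fderiv ℝ).comp_left (g := fun L => ‖L‖ ^ (3 / 2 : ℝ)) (by norm_num)

lemma integrable_gradPow (hφ : ContDiff ℝ 1 φ) (hc : HasCompactSupport φ) :
    Integrable (gradPow φ) :=
  (continuous_gradPow hφ).integrable_of_hasCompactSupport (hasCompactSupport_gradPow hc)

lemma setIntegral_norm_fderiv_le (hφ : ContDiff ℝ 1 φ) (hc : HasCompactSupport φ)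
    {R : Set (Euc 2)} (hR : MeasurableSet R) {a s m : ℝ} (hm : 0 < m) (hs : m ≤ s)
    (hsub : ∀ u ∈ refDisc, axisPoint a + s • u ∈ R) :
    ∫ u in refDisc, ‖fderiv ℝ φ (axisPoint a + s • u)‖ ≤
      volume.real refDisc ^ (1 / 3 : ℝ) *
        ((m ^ 2)⁻¹ * ∫ x in R, gradPow φ x) ^ (2 / 3 : ℝ) := by
  have hcont := hφ.continuous_fderiv one_ne_zero
  refine (setIntegral_le_rpow_mul (by fun_prop) fun _ => norm_nonneg _).trans ?_
  have h0 : 0 ≤ ∫ x in R, gradPow φ x := integral_nonneg gradPow_nonneg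
  have hle := setIntegral_comp_axisPoint_le (integrable_gradPow hφ hc) gradPow_nonneg hR
    (hm.trans_le hs) hsub
  have h1 : ∫ u in refDisc, gradPow φ (axisPoint a + s • u) ≤
      (m ^ 2)⁻¹ * ∫ x in R, gradPow φ x := by
    refine hle.trans ?_
    gcongr
  have h2 : 0 ≤ ∫ u in refDisc, gradPow φ (axisPoint a + s • u) :=
    integral_nonneg fun _ => gradPow_nonneg _
  exact mul_le_mul_of_nonneg_left (Real.rpow_le_rpow h2 h1 (by norm_num)) (by positivity)

/-- Moving a disc linearly changes the integral of `φ` by at most the energy in the region swept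
out. -/
lemma abs_discIntegral_sub_le (hφ : ContDiff ℝ 1 φ) (hc : HasCompactSupport φ)
    {R : Set (Euc 2)} (hR : MeasurableSet R) {a a' s s' m D : ℝ} (hm : 0 < m)
    (hs : m ≤ s) (hs' : m ≤ s') (hD : |a' - a| + 3 * |s' - s| ≤ D)
    (hsub : ∀ τ ∈ Icc (0 : ℝ) 1, ∀ u ∈ refDisc,
      axisPoint (a + τ * (a' - a)) + (s + τ * (s' - s)) • u ∈ R) :
    |discIntegral φ a' s' - discIntegral φ a s| ≤
      D * (volume.real refDisc ^ (1 / 3 : ℝ) *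
        ((m ^ 2)⁻¹ * ∫ x in R, gradPow φ x) ^ (2 / 3 : ℝ)) := by
  have hfin : IsFiniteMeasure (volume.restrict refDisc) :=
    ⟨by simpa using isCompact_refDisc.measure_lt_top⟩
  have hD0 : 0 ≤ D := le_trans (by positivity) hD
  have hcont := hφ.continuous_fderiv one_ne_zero
  obtain ⟨B, hB⟩ := (hc.fderiv ℝ).exists_bound_of_continuous hcont
  have hpt : ∀ (τ : ℝ) (u : Euc 2),
      axisPoint (a + τ * (a' - a)) + (s + τ * (s' - s)) • u =
        (axisPoint a + s • u) + τ • (axisPoint (a' - a) + (s' - s) • u) := by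
    intro τ u
    ext i
    fin_cases i
    · simp [axisPoint]; ring
    · simp [axisPoint]; ring
  have hv : ∀ u ∈ refDisc, ‖axisPoint (a' - a) + (s' - s) • u‖ ≤ D := by
    intro u hu
    refine (norm_add_le _ _).trans (le_trans ?_ hD)
    rw [norm_axisPoint, norm_smul, Real.norm_eq_abs]
    nlinarith [norm_le_three_of_mem_refDisc hu, abs_nonneg (s' - s)]
  let F : ℝ → Euc 2 → ℝ := fun τ u =>
    φ ((axisPoint a + s • u) + τ • (axisPoint (a' - a) + (s' - s) • u))
  let F' : ℝ → Euc 2 → ℝ := fun τ u =>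
    fderiv ℝ φ ((axisPoint a + s • u) + τ • (axisPoint (a' - a) + (s' - s) • u))
      (axisPoint (a' - a) + (s' - s) • u)
  have hFc : ∀ τ, Continuous (F τ) := fun τ => hφ.continuous.comp (by fun_prop)
  have hF'c : ∀ τ, Continuous (F' τ) := fun τ =>
    (hcont.comp (by fun_prop)).clm_apply (by fun_prop)
  have hderiv : ∀ τ, HasDerivAt (fun τ => ∫ u in refDisc, F τ u) (∫ u in refDisc, F' τ u) τ := by
    intro τ
    refine (hasDerivAt_integral_of_dominated_loc_of_deriv_le (F := F) (F' := F') (s := univ)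
      (bound := fun _ => B * D) Filter.univ_mem
      (Filter.Eventually.of_forall fun τ => (hFc τ).aestronglyMeasurable)
      ((hFc τ).continuousOn.integrableOn_compact isCompact_refDisc)
      (hF'c τ).aestronglyMeasurable ?_ (integrable_const _) ?_).2
    · refine ae_restrict_of_forall_mem measurableSet_refDisc fun u hu t _ => ?_
      exact (ContinuousLinearMap.le_opNorm _ _).trans
        (mul_le_mul (hB _) (hv u hu) (norm_nonneg _) ((norm_nonneg _).trans (hB 0)))
    · refine Filter.Eventually.of_forall fun u t _ => ?_
      have h1 : HasDerivAt (fun t : ℝ =>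
          (axisPoint a + s • u) + t • (axisPoint (a' - a) + (s' - s) • u))
          (axisPoint (a' - a) + (s' - s) • u) t := by
        simpa using ((hasDerivAt_id t).smul_const
          (axisPoint (a' - a) + (s' - s) • u)).const_add (axisPoint a + s • u)
      exact ((hφ.differentiable one_ne_zero _).hasFDerivAt).comp_hasDerivAt t h1
  have hbound : ∀ τ ∈ Ico (0 : ℝ) 1, ‖∫ u in refDisc, F' τ u‖ ≤
      D * (volume.real refDisc ^ (1 / 3 : ℝ) *
        ((m ^ 2)⁻¹ * ∫ x in R, gradPow φ x) ^ (2 / 3 : ℝ)) := by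
    rintro τ ⟨h0, h1⟩
    have hmτ : m ≤ s + τ * (s' - s) := by nlinarith
    refine le_trans ?_ (mul_le_mul_of_nonneg_left
      (setIntegral_norm_fderiv_le hφ hc hR hm hmτ (hsub τ ⟨h0, h1.le⟩)) hD0)
    rw [← integral_const_mul]
    refine (norm_integral_le_integral_norm _).trans (setIntegral_mono_on ?_ ?_
      measurableSet_refDisc fun u hu => ?_)
    · exact (hF'c τ).norm.continuousOn.integrableOn_compact isCompact_refDisc
    · exact (Continuous.continuousOn (by fun_prop)).integrableOn_compact isCompact_refDisc
    · rw [hpt, mul_comm]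
      exact (ContinuousLinearMap.le_opNorm _ _).trans
        (mul_le_mul_of_nonneg_left (hv u hu) (norm_nonneg _))
  have := norm_image_sub_le_of_norm_deriv_le_segment_01'
    (fun τ _ => (hderiv τ).hasDerivWithinAt) hbound
  have e1 : ∀ u, F 1 u = φ (axisPoint a' + s' • u) := by
    intro u; simp only [F]; rw [← hpt]; simp
  have e0 : ∀ u, F 0 u = φ (axisPoint a + s • u) := by
    intro u; simp only [F]; rw [← hpt]; simp
  simpa only [e1, e0, Real.norm_eq_abs, discIntegral] using this

end BoxIntegral

section Chaining

variable {φ : Euc 2 → ℝ} {lam : ℝ}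

lemma scale_mul_rpow (c W : ℝ) {m e : ℝ} (hm : 0 < m) (he : 0 ≤ e) :
    c * m * (W * ((m ^ 2)⁻¹ * e) ^ (2 / 3 : ℝ)) =
      c * W * (m ^ (-(1 / 3) : ℝ) * e ^ (2 / 3 : ℝ)) := by
  have h : m * ((m ^ 2)⁻¹) ^ (2 / 3 : ℝ) = m ^ (-(1 / 3) : ℝ) := by
    rw [← Real.rpow_natCast, ← Real.rpow_neg hm.le, ← Real.rpow_mul hm.le]
    nth_rewrite 1 [← Real.rpow_one m]
    rw [← Real.rpow_add hm]
    norm_num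
  rw [Real.mul_rpow (by positivity) he, ← h]
  ring

lemma rpow_two_thirds_add_le {x y z : ℝ} (hx : 0 ≤ x) (hy : 0 ≤ y) (h : x + y ≤ z) :
    (x ^ (2 / 3 : ℝ) + y ^ (2 / 3 : ℝ)) / 2 ≤ (1 / 2 : ℝ) ^ (2 / 3 : ℝ) * z ^ (2 / 3 : ℝ) := by
  have hc := (Real.concaveOn_rpow (p := 2 / 3) (by norm_num) (by norm_num)).2 (mem_Ici.2 hx)
    (mem_Ici.2 hy) (show (0 : ℝ) ≤ 1 / 2 by norm_num) (show (0 : ℝ) ≤ 1 / 2 by norm_num)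
    (by norm_num)
  simp only [smul_eq_mul] at hc
  have h2 : (1 / 2 * x + 1 / 2 * y) ^ (2 / 3 : ℝ) ≤ (1 / 2 * z) ^ (2 / 3 : ℝ) :=
    Real.rpow_le_rpow (by positivity) (by linarith) (by norm_num)
  rw [Real.mul_rpow (by norm_num) (by linarith)] at h2
  linarith

/-- The closed rectangle `[a, a + l] × [0, 2l]`. -/
def column (a l : ℝ) : Set (Euc 2) := {x | x 0 ∈ Icc a (a + l) ∧ x 1 ∈ Icc 0 (2 * l)}

lemma isClosed_column (a l : ℝ) : IsClosed (column a l) :=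
  (isClosed_Icc.preimage (by fun_prop : Continuous fun x : Euc 2 => x 0)).inter
    (isClosed_Icc.preimage (by fun_prop : Continuous fun x : Euc 2 => x 1))

/-- The average of `discIntegral φ` over the `2 ^ n` Cantor cells `n` generations below
`[a, a + l]`. -/
def descendantMean (lam : ℝ) (φ : Euc 2 → ℝ) : ℕ → ℝ → ℝ → ℝ
  | 0, a, l => discIntegral φ a l
  | n + 1, a, l => (descendantMean lam φ n a (lam * l) +
      descendantMean lam φ n (a + (1 - lam) * l) (lam * l)) / 2

lemma abs_discIntegral_child_sub_le (hφ : ContDiff ℝ 1 φ) (hc : HasCompactSupport φ)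
    (h0 : 0 < lam) (h1 : lam < 1 / 2) {a l b : ℝ} (hl : 0 < l) (hb0 : 0 ≤ b)
    (hb1 : b ≤ 1 - lam) :
    |discIntegral φ (a + b * l) (lam * l) - discIntegral φ a l| ≤
      4 / lam * volume.real refDisc ^ (1 / 3 : ℝ) * lam ^ (-(1 / 3) : ℝ) *
        (l ^ (-(1 / 3) : ℝ) * (∫ x in column a l, gradPow φ x) ^ (2 / 3 : ℝ)) := by
  have hm : 0 < lam * l := by positivity
  have key := abs_discIntegral_sub_le hφ hc (isClosed_column a l).measurableSet (a := a)
    (a' := a + b * l) (s := l) (s' := lam * l) (D := 4 / lam * (lam * l)) hm (by nlinarith) le_rfl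
    (by
      rw [add_sub_cancel_left, abs_of_nonneg (by positivity), abs_of_nonpos (by nlinarith)]
      field_simp
      nlinarith)
    (by
      rintro τ ⟨hτ0, hτ1⟩ u hu
      obtain ⟨hu1, hu2⟩ := mem_refDisc_zero hu
      obtain ⟨hu3, hu4⟩ := mem_refDisc_one hu
      have e : l + τ * (lam * l - l) = l * (1 - τ * (1 - lam)) := by ring
      have e0 : 0 ≤ 1 - τ * (1 - lam) := by nlinarith
      have e1 : 1 - τ * (1 - lam) ≤ 1 := by nlinarith
      have e2 : τ * b ≤ τ * (1 - lam) := by gcongr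
      have hq0 : 0 ≤ τ * b := by positivity
      simp only [column, mem_ofPred_eq, axisPoint_add_smul_zero, axisPoint_add_smul_one, mem_Icc, e,
        add_sub_cancel_left]
      generalize 1 - τ * (1 - lam) = w at *
      have e3 : w * u 0 ≤ w := by nlinarith
      have e4 : 0 ≤ w * u 0 := by positivity
      have e5 : w * u 1 ≤ 2 := by nlinarith
      have e6 : 0 ≤ w * u 1 := mul_nonneg e0 (by linarith)
      refine ⟨⟨?_, ?_⟩, ?_, ?_⟩ <;> nlinarith)
  rw [scale_mul_rpow _ _ hm (integral_nonneg gradPow_nonneg),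
    Real.mul_rpow h0.le hl.le] at key
  exact key.trans_eq (by ring)

lemma setIntegral_column_children_le (hφ : ContDiff ℝ 1 φ) (hc : HasCompactSupport φ)
    (h1 : lam < 1 / 2) {a l : ℝ} (hl : 0 < l) :
    (∫ x in column a (lam * l), gradPow φ x) +
      ∫ x in column (a + (1 - lam) * l) (lam * l), gradPow φ x ≤
        ∫ x in column a l, gradPow φ x := by
  have hint := integrable_gradPow hφ hc
  have hdisj : Disjoint (column a (lam * l)) (column (a + (1 - lam) * l) (lam * l)) := by
    refine disjoint_left.2 ?_
    rintro x ⟨⟨_, h2⟩, _⟩ ⟨⟨h3, _⟩, _⟩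
    nlinarith
  rw [← setIntegral_union hdisj (isClosed_column _ _).measurableSet hint.integrableOn
    hint.integrableOn]
  refine setIntegral_mono_set hint.integrableOn (Filter.Eventually.of_forall gradPow_nonneg)
    (LE.le.eventuallyLE ?_)
  rintro x (⟨⟨h2, h3⟩, h4, h5⟩ | ⟨⟨h2, h3⟩, h4, h5⟩) <;>
    refine ⟨⟨?_, ?_⟩, h4, ?_⟩ <;> nlinarith

lemma descent_ratio_lt_one (h : 1 / 4 < lam) :
    lam ^ (-(1 / 3) : ℝ) * (1 / 2 : ℝ) ^ (2 / 3 : ℝ) < 1 := by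
  have h2 : lam ^ (-(1 / 3) : ℝ) < (1 / 4 : ℝ) ^ (-(1 / 3) : ℝ) :=
    Real.rpow_lt_rpow_of_neg (by norm_num) h (by norm_num)
  have h3 : (1 / 4 : ℝ) ^ (-(1 / 3) : ℝ) = (1 / 2 : ℝ) ^ (-(2 / 3) : ℝ) := by
    rw [show (1 / 4 : ℝ) = (1 / 2) ^ (2 : ℝ) by norm_num, ← Real.rpow_mul (by norm_num)]
    norm_num
  calc _ < (1 / 2 : ℝ) ^ (-(2 / 3) : ℝ) * (1 / 2 : ℝ) ^ (2 / 3 : ℝ) := by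
        rw [← h3]; gcongr
    _ = 1 := by rw [← Real.rpow_add (by norm_num)]; norm_num

lemma exists_descendantMean_le (h : 1 / 4 < lam) (h1 : lam < 1 / 2) :
    ∃ M > 0, ∀ φ : Euc 2 → ℝ, ContDiff ℝ 1 φ → HasCompactSupport φ → ∀ (n : ℕ) (a l : ℝ), 0 < l →
      |descendantMean lam φ n a l - discIntegral φ a l| ≤
        M * (l ^ (-(1 / 3) : ℝ) * (∫ x in column a l, gradPow φ x) ^ (2 / 3 : ℝ)) := by
  have h0 : 0 < lam := by linarith
  have hV := volume_real_refDisc_pos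
  have hκ := descent_ratio_lt_one h
  set κ := lam ^ (-(1 / 3) : ℝ) * (1 / 2 : ℝ) ^ (2 / 3 : ℝ) with hκ_def
  set K := 4 / lam * volume.real refDisc ^ (1 / 3 : ℝ) * lam ^ (-(1 / 3) : ℝ) with hK_def
  have hK : 0 < K := by positivity
  refine ⟨K / (1 - κ), div_pos hK (by linarith), fun φ hφ hc n => ?_⟩
  set M := K / (1 - κ) with hM_def
  have hM : 0 < M := div_pos hK (by linarith)
  have hMK : M * κ + K = M := by
    rw [hM_def]
    field_simp [(by linarith : (1 - κ) ≠ 0)]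
    ring
  induction n with
  | zero =>
    intro a l hl
    simp only [descendantMean, sub_self, abs_zero]
    have : 0 ≤ ∫ x in column a l, gradPow φ x := integral_nonneg gradPow_nonneg
    positivity
  | succ n ih =>
    intro a l hl
    have hl' : 0 < lam * l := by positivity
    have d1 := abs_discIntegral_child_sub_le hφ hc h0 h1 (a := a) hl le_rfl
      (by linarith : (0 : ℝ) ≤ 1 - lam)
    have d2 := abs_discIntegral_child_sub_le hφ hc h0 h1 (a := a) hl
      (by linarith : (0 : ℝ) ≤ 1 - lam) le_rfl
    rw [zero_mul, add_zero] at d1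
    have i1 := ih a (lam * l) hl'
    have i2 := ih (a + (1 - lam) * l) (lam * l) hl'
    have hsum := rpow_two_thirds_add_le (integral_nonneg gradPow_nonneg)
      (integral_nonneg gradPow_nonneg) (setIntegral_column_children_le hφ hc h1 (a := a) hl)
    rw [Real.mul_rpow h0.le hl.le] at i1 i2
    rw [← hK_def] at d1 d2
    set e := (∫ x in column a l, gradPow φ x) ^ (2 / 3 : ℝ)
    set e1 := (∫ x in column a (lam * l), gradPow φ x) ^ (2 / 3 : ℝ)
    set e2 := (∫ x in column (a + (1 - lam) * l) (lam * l), gradPow φ x) ^ (2 / 3 : ℝ)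
    have hmul : M * (lam ^ (-(1 / 3) : ℝ) * l ^ (-(1 / 3) : ℝ)) * ((e1 + e2) / 2) ≤
        M * (lam ^ (-(1 / 3) : ℝ) * l ^ (-(1 / 3) : ℝ)) * ((1 / 2 : ℝ) ^ (2 / 3 : ℝ) * e) := by
      gcongr
    have htotal : M * (lam ^ (-(1 / 3) : ℝ) * l ^ (-(1 / 3) : ℝ)) * ((1 / 2 : ℝ) ^ (2 / 3 : ℝ) * e)
        + K * (l ^ (-(1 / 3) : ℝ) * e) = M * (l ^ (-(1 / 3) : ℝ) * e) := by
      linear_combination (l ^ (-(1 / 3) : ℝ) * e) * hMK - M * (l ^ (-(1 / 3) : ℝ) * e) * hκ_def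
    simp only [descendantMean]
    rw [abs_le] at *
    constructor <;> linarith [d1.1, d1.2, d2.1, d2.2, i1.1, i1.2, i2.1, i2.2]

lemma le_discIntegral (hφ : Continuous φ) {η a l : ℝ} (hl : 0 < l) (hlη : 3 * l < η)
    (hη : ∀ x y, dist x y < η → dist (φ x) (φ y) < 1 / 2) (ha : 1 ≤ φ (axisPoint a)) :
    volume.real refDisc / 2 ≤ discIntegral φ a l := by
  have hc : volume.real refDisc / 2 = ∫ _ in refDisc, (1 / 2 : ℝ) := by
    rw [setIntegral_const, smul_eq_mul]
    ring
  rw [hc]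
  refine setIntegral_mono_on ?_ ?_ measurableSet_refDisc fun u hu => ?_
  · exact continuousOn_const.integrableOn_compact isCompact_refDisc
  · exact (Continuous.continuousOn (by fun_prop)).integrableOn_compact isCompact_refDisc
  · have hd : dist (axisPoint a + l • u) (axisPoint a) < η := by
      rw [dist_self_add_left, norm_smul, Real.norm_eq_abs, abs_of_pos hl]
      nlinarith [norm_le_three_of_mem_refDisc hu]
    have := hη _ _ hd
    rw [Real.dist_eq, abs_lt] at this
    linarith [this.1]

lemma le_descendantMean (h0 : 0 < lam) (h1 : lam < 1 / 2) (hφ : Continuous φ) {η : ℝ}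
    (hη : ∀ x y, dist x y < η → dist (φ x) (φ y) < 1 / 2) (n : ℕ) :
    ∀ a l : ℝ, 0 < l → 3 * (lam ^ n * l) < η → IsCantorCell lam a l →
      (∀ b ∈ midCantorSet lam, b ∈ Icc a (a + l) → 1 ≤ φ (axisPoint b)) →
      volume.real refDisc / 2 ≤ descendantMean lam φ n a l := by
  induction n with
  | zero =>
    intro a l hl hlη hcell hge
    rw [pow_zero, one_mul] at hlη
    exact le_discIntegral hφ hl hlη hη (hge a hcell.left_mem ⟨le_rfl, by linarith⟩)
  | succ n ih =>
    intro a l hl hlη hcell hge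
    have hl' : 0 < lam * l := by positivity
    have hlη' : 3 * (lam ^ n * (lam * l)) < η := by rwa [← mul_assoc (lam ^ n), ← pow_succ]
    have i1 := ih a (lam * l) hl' hlη' (hcell.lower h0 h1) fun b hb hI =>
      hge b hb ⟨hI.1, by nlinarith [hI.2]⟩
    have i2 := ih (a + (1 - lam) * l) (lam * l) hl' hlη' (hcell.upper h0 h1) fun b hb hI =>
      hge b hb ⟨by nlinarith [hI.1], by nlinarith [hI.2]⟩
    simp only [descendantMean]
    linarith

lemma discIntegral_eq_zero {a s ρ : ℝ} (hs : 0 ≤ s) (hρ : tsupport φ ⊆ closedBall 0 ρ)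
    (hsρ : ρ < s) : discIntegral φ a s = 0 := by
  refine setIntegral_eq_zero_of_forall_eq_zero fun u hu => ?_
  refine image_eq_zero_of_notMem_tsupport fun hmem => ?_
  have h := (PiLp.norm_apply_le _ (1 : Fin 2)).trans (mem_closedBall_zero_iff.1 (hρ hmem))
  rw [axisPoint_add_smul_one, Real.norm_eq_abs] at h
  nlinarith [(mem_refDisc_one hu).1, le_abs_self (s * u 1)]

lemma abs_apply_le_norm (x : Euc 2) (i : Fin 2) : |x i| ≤ ‖x‖ := PiLp.norm_apply_le x i

/-- Discs based away from the origin stay away from it. -/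
lemma le_norm_axisPoint_add_smul {a s δ : ℝ} (hs : 0 ≤ s) (hδ : δ ≤ |a|)
    {u : Euc 2} (hu : u ∈ refDisc) : δ / 2 ≤ ‖axisPoint a + s • u‖ := by
  obtain ⟨hu1, hu2⟩ := mem_refDisc_zero hu
  obtain ⟨hu3, hu4⟩ := mem_refDisc_one hu
  have c0 := abs_apply_le_norm (axisPoint a + s • u) 0
  have c1 := abs_apply_le_norm (axisPoint a + s • u) 1
  rw [axisPoint_add_smul_zero] at c0
  rw [axisPoint_add_smul_one] at c1
  have d1 := le_abs_self (s * u 1)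
  rcases abs_cases a with ⟨h, _⟩ | ⟨h, _⟩
  · have := le_abs_self (a + s * u 0)
    have : 0 ≤ s * u 0 := by positivity
    linarith
  · have := neg_le_abs (a + s * u 0)
    nlinarith

lemma exists_discIntegral_le :
    ∃ M > 0, ∀ φ : Euc 2 → ℝ, ContDiff ℝ 1 φ → HasCompactSupport φ → ∀ δ a s : ℝ, 0 < s →
      δ ≤ |a| → |discIntegral φ a s| ≤
        M * (s ^ (-(1 / 3) : ℝ) * (∫ x in {x | δ / 2 ≤ ‖x‖}, gradPow φ x) ^ (2 / 3 : ℝ)) := by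
  have hV := volume_real_refDisc_pos
  set K := 3 * (8 - 1) * volume.real refDisc ^ (1 / 3 : ℝ) with hK_def
  have hK : 0 < K := by positivity
  refine ⟨2 * K, by positivity, fun φ hφ hc δ a s hs hδ => ?_⟩
  have hR : MeasurableSet {x : Euc 2 | δ / 2 ≤ ‖x‖} :=
    measurableSet_le measurable_const measurable_norm
  have hE : 0 ≤ ∫ x in {x | δ / 2 ≤ ‖x‖}, gradPow φ x := integral_nonneg gradPow_nonneg
  have step : ∀ s : ℝ, 0 < s → |discIntegral φ a (8 * s) - discIntegral φ a s| ≤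
      K * (s ^ (-(1 / 3) : ℝ) * (∫ x in {x | δ / 2 ≤ ‖x‖}, gradPow φ x) ^ (2 / 3 : ℝ)) := by
    intro s hs
    have := abs_discIntegral_sub_le hφ hc hR (a := a) (a' := a) (s := s) (s' := 8 * s)
      (D := 3 * (8 - 1) * s) hs le_rfl (by linarith)
      (by rw [sub_self, abs_zero, abs_of_nonneg (by linarith)]; linarith)
      (fun τ hτ u hu => by
        rw [sub_self, mul_zero, add_zero]
        exact le_norm_axisPoint_add_smul (by nlinarith [hτ.1]) hδ hu)
    rwa [scale_mul_rpow _ _ hs hE] at this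
  have climb : ∀ (n : ℕ) (s : ℝ), 0 < s → discIntegral φ a (8 ^ n * s) = 0 →
      |discIntegral φ a s| ≤ 2 * K * (s ^ (-(1 / 3) : ℝ) *
        (∫ x in {x | δ / 2 ≤ ‖x‖}, gradPow φ x) ^ (2 / 3 : ℝ)) := by
    intro n
    induction n with
    | zero =>
      intro s hs hz
      rw [pow_zero, one_mul] at hz
      rw [hz, abs_zero]
      positivity
    | succ n ih =>
      intro s hs hz
      have i := ih (8 * s) (by positivity) (by rwa [← mul_assoc, ← pow_succ])
      have h8 : (8 : ℝ) ^ (-(1 / 3) : ℝ) = 1 / 2 := by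
        rw [show (8 : ℝ) = 2 ^ (3 : ℝ) by norm_num, ← Real.rpow_mul (by norm_num)]
        norm_num [Real.rpow_neg_one]
      rw [Real.mul_rpow (by norm_num) hs.le, h8] at i
      have d := step s hs
      rw [abs_le] at *
      constructor <;> linarith [i.1, i.2, d.1, d.2]
  obtain ⟨ρ, hρ⟩ := hc.isCompact.isBounded.subset_closedBall 0
  obtain ⟨n, hn⟩ := pow_unbounded_of_one_lt (ρ / s) (by norm_num : (1 : ℝ) < 8)
  exact climb n s hs (discIntegral_eq_zero (by positivity) hρ ((div_lt_iff₀ hs).1 hn))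

/-- A test function that is at least `1` on a Cantor cell of length `l` has `3/2`-energy at least
`c l^{1/2}` away from the origin. -/
lemma exists_le_setIntegral_gradPow (h : 1 / 4 < lam) (h1 : lam < 1 / 2) :
    ∃ c > 0, ∀ φ : Euc 2 → ℝ, ContDiff ℝ 1 φ → HasCompactSupport φ → ∀ a l : ℝ, 0 < l →
      l ≤ (1 / 2 - lam) / 2 → IsCantorCell lam a l →
      (∀ b ∈ midCantorSet lam, b ∈ Icc a (a + l) → 1 ≤ φ (axisPoint b)) →
      c * l ^ (1 / 2 : ℝ) ≤ ∫ x in {x | (1 / 2 - lam) / 2 ≤ ‖x‖}, gradPow φ x := by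
  have h0 : 0 < lam := by linarith
  have hV := volume_real_refDisc_pos
  obtain ⟨M₁, hM₁, hdown⟩ := exists_descendantMean_le h h1
  obtain ⟨M₂, hM₂, hup⟩ := exists_discIntegral_le
  refine ⟨(volume.real refDisc / 2 / (M₁ + M₂)) ^ (3 / 2 : ℝ), by positivity, ?_⟩
  intro φ hφ hc a l hl hlδ hcell hge
  have hδ := le_abs_of_mem_midCantorSet h0 hcell.left_mem
  set δ := 1 / 2 - lam
  obtain ⟨η, hη0, hη⟩ := Metric.uniformContinuous_iff.1
    (hc.uniformContinuous_of_continuous hφ.continuous) (1 / 2) (by norm_num)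
  obtain ⟨n, hn⟩ := exists_pow_lt_of_lt_one (show 0 < η / (3 * l) by positivity)
    (show lam < 1 by linarith)
  rw [lt_div_iff₀ (by positivity)] at hn
  have hlow := le_descendantMean h0 h1 hφ.continuous (fun x y hxy => hη hxy) n a l hl (by linarith)
    hcell hge
  have hd := hdown φ hφ hc n a l hl
  have hu := hup φ hφ hc δ a l hl hδ
  have hcol : ∫ x in column a l, gradPow φ x ≤ ∫ x in {x | δ / 2 ≤ ‖x‖}, gradPow φ x := by
    refine setIntegral_mono_set (integrable_gradPow hφ hc).integrableOn
      (Filter.Eventually.of_forall gradPow_nonneg) (LE.le.eventuallyLE ?_)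
    rintro x ⟨⟨hx0, hx1⟩, _⟩
    refine le_trans ?_ (abs_apply_le_norm x 0)
    rcases abs_cases a with ⟨ha, _⟩ | ⟨ha, _⟩
    · linarith [le_abs_self (x 0)]
    · linarith [neg_le_abs (x 0)]
  set G := ∫ x in {x | δ / 2 ≤ ‖x‖}, gradPow φ x
  have hG : 0 ≤ G := integral_nonneg gradPow_nonneg
  have hcol' : M₁ * (l ^ (-(1 / 3) : ℝ) * (∫ x in column a l, gradPow φ x) ^ (2 / 3 : ℝ)) ≤
      M₁ * (l ^ (-(1 / 3) : ℝ) * G ^ (2 / 3 : ℝ)) := by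
    have := Real.rpow_le_rpow (integral_nonneg gradPow_nonneg) hcol
      (by norm_num : (0 : ℝ) ≤ 2 / 3)
    gcongr
  have hmain : volume.real refDisc / 2 ≤ (M₁ + M₂) * (l ^ (-(1 / 3) : ℝ) * G ^ (2 / 3 : ℝ)) := by
    rw [abs_le] at hd hu
    linarith [hd.2, hu.2]
  have hroot : volume.real refDisc / 2 / (M₁ + M₂) * l ^ (1 / 3 : ℝ) ≤ G ^ (2 / 3 : ℝ) := by
    rw [Real.rpow_neg hl.le] at hmain
    have : 0 < l ^ (1 / 3 : ℝ) := by positivity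
    rw [div_mul_eq_mul_div, div_le_iff₀ (by positivity)]
    calc _ ≤ (M₁ + M₂) * ((l ^ (1 / 3 : ℝ))⁻¹ * G ^ (2 / 3 : ℝ)) * l ^ (1 / 3 : ℝ) := by gcongr
      _ = _ := by field_simp
  have hpow := Real.rpow_le_rpow (by positivity) hroot (by norm_num : (0 : ℝ) ≤ 3 / 2)
  rw [Real.mul_rpow (by positivity) (by positivity), ← Real.rpow_mul hl.le, ← Real.rpow_mul hG]
    at hpow
  norm_num at hpow ⊢
  exact hpow

end Chaining

section Capacity

variable {lam : ℝ}

lemma cube_subset_ball {x₀ : Euc 2} {r : ℝ} (hr : 0 < r) : cube 2 x₀ r ⊆ ball x₀ (2 * r) := by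
  intro x hx
  have h0 := sq_lt_sq' (neg_lt_of_abs_lt (hx 0)) (lt_of_abs_lt (hx 0))
  have h1 := sq_lt_sq' (neg_lt_of_abs_lt (hx 1)) (lt_of_abs_lt (hx 1))
  rw [mem_ball_iff_norm]
  refine lt_of_pow_lt_pow_left₀ 2 (by positivity) ?_
  rw [EuclideanSpace.real_norm_sq_eq, Fin.sum_univ_two, PiLp.sub_apply, PiLp.sub_apply]
  nlinarith

lemma norm_le_half_of_mem_cantorF {x : Euc 2} (hx : x ∈ cantorF lam) : ‖x‖ ≤ 1 / 2 := by
  obtain ⟨h1, h2⟩ := hx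
  obtain ⟨h3, h4⟩ := midCantorSet_subset_Icc h2
  refine abs_le_of_sq_le_sq' ?_ (by norm_num) |>.2
  rw [EuclideanSpace.real_norm_sq_eq, Fin.sum_univ_two, h1]
  nlinarith

lemma setIntegral_cube_le {x₀ : Euc 2} (hx₀ : ‖x₀‖ ≤ 1 / 2) {r : ℝ} (hr : 0 < r) (hr1 : r < 1 / 3) :
    ∫ x in cube 2 x₀ r, ‖x‖ ^ ((1 : ℝ) / 2) ≤ 8 * Real.pi * r ^ 2 := by
  have hfin : volume (ball x₀ (2 * r)) ≠ ⊤ := measure_ball_lt_top.ne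
  have hle := norm_setIntegral_le_of_norm_le_const (μ := volume) (s := cube 2 x₀ r)
    (f := fun x => ‖x‖ ^ ((1 : ℝ) / 2)) (C := 2)
    ((measure_mono (cube_subset_ball hr)).trans_lt hfin.lt_top) (fun x hx => by
      have hx' := mem_ball_iff_norm.1 (cube_subset_ball hr hx)
      have hx4 : ‖x‖ ≤ 4 := by linarith [norm_le_norm_add_norm_sub' x x₀]
      rw [Real.norm_of_nonneg (by positivity), ← Real.sqrt_eq_rpow, Real.sqrt_le_iff]
      norm_num
      exact hx4)
  have hvol : volume.real (cube 2 x₀ r) ≤ 4 * Real.pi * r ^ 2 := by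
    refine (measureReal_mono (cube_subset_ball hr) hfin).trans_eq ?_
    rw [Measure.real, EuclideanSpace.volume_ball_fin_two, ENNReal.toReal_mul, ENNReal.toReal_pow,
      ENNReal.toReal_ofReal (by positivity), ENNReal.toReal_ofReal Real.pi_pos.le]
    ring
  refine (le_abs_self _).trans (hle.trans ?_)
  linarith

lemma exists_isCantorCell_near (h0 : 0 < lam) (h1 : lam < 1 / 2) {x ρ : ℝ}
    (hx : x ∈ midCantorSet lam) (hρ : 0 < ρ) (hρ1 : ρ ≤ 1) :
    ∃ a l, 0 < l ∧ lam * ρ ≤ l ∧ l < ρ ∧ IsCantorCell lam a l ∧ x ∈ Icc a (a + l) := by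
  obtain ⟨n, hn1, hn2⟩ := exists_nat_pow_near_of_lt_one hρ hρ1 h0 (by linarith)
  obtain ⟨a, ha, t, ht, rfl⟩ := exists_isCantorCell h0 h1 hx (n + 1)
  have hl : 0 < lam ^ (n + 1) := by positivity
  obtain ⟨ht1, ht2⟩ := midCantorSet_subset_Icc ht
  refine ⟨a, lam ^ (n + 1), hl, ?_, hn1, ha, ?_, ?_⟩
  · rw [pow_succ']
    gcongr
  · nlinarith
  · nlinarith

lemma setIntegral_gradPow_le {φ : Euc 2 → ℝ} (hφ : ContDiff ℝ 1 φ) (hc : HasCompactSupport φ)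
    {d : ℝ} (hd : 0 < d) :
    d ^ (1 / 2 : ℝ) * ∫ x in {x | d ≤ ‖x‖}, gradPow φ x ≤
      ∫ x, ‖fderiv ℝ φ x‖ ^ (3 / 2 : ℝ) * ‖x‖ ^ ((1 : ℝ) / 2) := by
  have hR : MeasurableSet {x : Euc 2 | d ≤ ‖x‖} :=
    measurableSet_le measurable_const measurable_norm
  have hint : Integrable fun x => gradPow φ x * ‖x‖ ^ ((1 : ℝ) / 2) := by
    refine Continuous.integrable_of_hasCompactSupport ?_ (hasCompactSupport_gradPow hc).mul_right
    exact (continuous_gradPow hφ).mul (continuous_norm.rpow_const fun _ => Or.inr (by norm_num))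
  rw [← integral_const_mul]
  calc _ ≤ ∫ x in {x | d ≤ ‖x‖}, gradPow φ x * ‖x‖ ^ ((1 : ℝ) / 2) := by
        refine setIntegral_mono_on ((integrable_gradPow hφ hc).const_mul _).integrableOn
          hint.integrableOn hR fun x hx => ?_
        rw [mul_comm]
        exact mul_le_mul_of_nonneg_left (Real.rpow_le_rpow hd.le hx (by norm_num))
          (gradPow_nonneg x)
    _ ≤ _ := setIntegral_le_integral hint (Filter.Eventually.of_forall fun x =>
        mul_nonneg (gradPow_nonneg x) (by positivity))

lemma capSet_nonempty (K : Set (Euc 2)) (hK : K ⊆ cantorF lam) :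
    {t | ∃ φ : Euc 2 → ℝ, ContDiff ℝ (⊤ : ℕ∞) φ ∧ HasCompactSupport φ ∧
      tsupport φ ⊆ univ ∧ (∀ x ∈ K, 1 ≤ φ x) ∧
      t = ∫ x in univ, ‖fderiv ℝ φ x‖ ^ (3 / 2 : ℝ) * ‖x‖ ^ ((1 : ℝ) / 2)}.Nonempty := by
  let f : ContDiffBump (0 : Euc 2) := ⟨1, 2, one_pos, one_lt_two⟩
  refine ⟨_, f, f.contDiff, f.hasCompactSupport, subset_univ _, fun x hx => ?_, rfl⟩
  refine (f.one_of_mem_closedBall (mem_closedBall_zero_iff.2 ?_)).ge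
  exact (norm_le_half_of_mem_cantorF (hK hx)).trans (by norm_num)

end Capacity

/-- for `λ ∈ (0,1/2)` with `log 2 / (−log λ) > 2 − q/q₀`, `q = 3/2`,
`q₀ = 13/10`, the Cantor set `F = C_λ ⊆ ℝ²` has zero 1-dimensional Lebesgue measure
yet satisfies the scaling-invariant capacity density condition
`Cap_{q,ω}(F ∩ Q_r(x₀), ℝ²) ≥ c₀ r^{-q} ω(Q_r(x₀))` for `ω(x) = |x|^{1/2}`. -/
theorem cantor_capacity_density
    (lam : ℝ) (hlam : lam ∈ Set.Ioo (0:ℝ) (1/2))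
    (hdim : 2 - (3/2 : ℝ) / (13/10 : ℝ) < Real.log 2 / (-Real.log lam)) :
    volume (midCantorSet lam) = 0 ∧
    ∃ c₀ > (0:ℝ), ∀ x₀ ∈ cantorF lam, ∀ r : ℝ, 0 < r → r < 1/3 →
      c₀ * r ^ (-(3/2 : ℝ)) * (∫ x in cube 2 x₀ r, ‖x‖ ^ ((1:ℝ)/2)) ≤
        Cap 2 (3/2) (fun x => ‖x‖ ^ ((1:ℝ)/2))
          (cantorF lam ∩ closure (cube 2 x₀ r)) Set.univ := by
  obtain ⟨h0, h1⟩ := hlam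
  have h4 := quarter_lt_of_dim h0 h1 hdim
  refine ⟨volume_midCantorSet h0 h1, ?_⟩
  obtain ⟨c, hc, hlow⟩ := exists_le_setIntegral_gradPow h4 h1
  set d := (1 / 2 - lam) / 2 with hd_def
  have hd : 0 < d := by linarith
  refine ⟨d ^ (1 / 2 : ℝ) * c * (lam * d) ^ (1 / 2 : ℝ) / (8 * Real.pi), by positivity, ?_⟩
  intro x₀ hx₀ r hr hr1
  refine le_csInf (capSet_nonempty _ inter_subset_left) ?_
  rintro _ ⟨φ, hφ, hφc, -, hφK, rfl⟩
  replace hφ : ContDiff ℝ 1 φ := hφ.of_le (by exact_mod_cast le_top)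
  rw [setIntegral_univ]
  obtain ⟨a, l, hl, hl1, hl2, hcell, hxa⟩ := exists_isCantorCell_near h0 h1 hx₀.2
    (ρ := d * r) (by positivity) (by nlinarith)
  have hlr : l < r := by nlinarith
  have key := hlow φ hφ hφc a l hl (by nlinarith) hcell fun b hb hba => by
    refine hφK _ ⟨⟨by simp [axisPoint], by simpa [axisPoint] using hb⟩, subset_closure ?_⟩
    intro i
    fin_cases i
    · simp only [axisPoint, Fin.zero_eta, PiLp.toLp_apply, Matrix.cons_val_zero]
      rw [abs_lt]
      constructor <;> linarith [hba.1, hba.2, hxa.1, hxa.2]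
    · simpa [axisPoint, hx₀.1] using hr
  have hr2 : r ^ (-(3 / 2 : ℝ)) * r ^ 2 = r ^ (1 / 2 : ℝ) := by
    rw [← Real.rpow_natCast, ← Real.rpow_add hr]
    norm_num
  calc d ^ (1 / 2 : ℝ) * c * (lam * d) ^ (1 / 2 : ℝ) / (8 * Real.pi) * r ^ (-(3 / 2 : ℝ)) *
        (∫ x in cube 2 x₀ r, ‖x‖ ^ ((1 : ℝ) / 2))
      ≤ d ^ (1 / 2 : ℝ) * c * (lam * d) ^ (1 / 2 : ℝ) / (8 * Real.pi) * r ^ (-(3 / 2 : ℝ)) *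
        (8 * Real.pi * r ^ 2) := by
        gcongr
        exact setIntegral_cube_le (norm_le_half_of_mem_cantorF hx₀) hr hr1
    _ = d ^ (1 / 2 : ℝ) * (c * (lam * (d * r)) ^ (1 / 2 : ℝ)) := by
        rw [← mul_assoc lam, Real.mul_rpow (by positivity) hr.le, ← hr2]
        field_simp
    _ ≤ d ^ (1 / 2 : ℝ) * (c * l ^ (1 / 2 : ℝ)) := by gcongr
    _ ≤ d ^ (1 / 2 : ℝ) * ∫ x in {x | d ≤ ‖x‖}, gradPow φ x := by gcongr
    _ ≤ _ := setIntegral_gradPow_le hφ hφc hd
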